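/- There exist a function a ∈ C²(ℝ) with a' > 0 and a'' > 0 on ℝ, a function F with F' = a, an integer N ≥ 6, a set X = {X_1,…,X_N} ⊂ K_a of N distinct points, and a matrix Q ∈ ℝ^{3×2}, such that rank(A_X − Π^N(Q)) = 2. -/

import Mathlib

open Matrix

noncomputable section

/-- The map `P(u,v)` into `ℝ^{3×2}` from the paper. -/
def Pmat (a F : ℝ → ℝ) (u v : ℝ) : Matrix (Fin 3) (Fin 2) ℝ :=
  !![u, v; a v, u; u * a v, u ^ 2 / 2 + F v]

/-- The ordered family `X` forms a `T_N` configuration. -/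
def IsTNConfig {m n N : ℕ} (X : Fin N → Matrix (Fin m) (Fin n) ℝ) : Prop :=
  4 ≤ N ∧ Function.Injective X ∧
    (∀ i j, i ≠ j → (X i - X j).rank ≠ 1) ∧
    ∃ (B : Matrix (Fin m) (Fin n) ℝ) (C : Fin N → Matrix (Fin m) (Fin n) ℝ)
      (κ : Fin N → ℝ),
      (∀ i, 1 < κ i) ∧ (∀ i, (C i).rank = 1) ∧ (∑ i, C i = 0) ∧
      ∀ i, X i = B + (∑ j ∈ Finset.univ.filter (fun j => j < i), C j) + κ i • C i

/-- The family `X` has an order (enumeration) that forms a `T_N` configuration. -/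
def HasTNOrder {m n N : ℕ} (X : Fin N → Matrix (Fin m) (Fin n) ℝ) : Prop :=
  ∃ σ : Equiv.Perm (Fin N), IsTNConfig (X ∘ σ)

/-- The matrix `A_X - Π^N(Q) ∈ ℝ^{3 × 2N}`, with the `2N` columns indexed by
`Fin N ⊕ Fin N`: the first `N` columns are `(u_j, a(v_j), u_j a(v_j))ᵀ - (first column of Q)`
and the last `N` columns are `(v_j, u_j, u_j²/2 + F(v_j))ᵀ - (second column of Q)`. -/
def AmatDiff (a F : ℝ → ℝ) {N : ℕ} (u v : Fin N → ℝ)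
    (Q : Matrix (Fin 3) (Fin 2) ℝ) : Matrix (Fin 3) (Fin N ⊕ Fin N) ℝ :=
  Matrix.of fun i => Sum.elim
    (fun j => Pmat a F (u j) (v j) i 0 - Q i 0)
    (fun j => Pmat a F (u j) (v j) i 1 - Q i 1)

/-- The exponential sum `e^v + c (50/69 e^v)^20 + d (5/7 e^v)^240`, written in `y = e^v`. -/
def lacunary (c d y : ℝ) : ℝ := y + c * (50 / 69 * y) ^ 20 + d * (5 / 7 * y) ^ 240

theorem hasDerivAt_lacunary_exp (c d x : ℝ) :
    HasDerivAt (fun v => lacunary c d (Real.exp v))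
      (lacunary (20 * c) (240 * d) (Real.exp x)) x := by
  have he := Real.hasDerivAt_exp x
  have h := (he.add (((he.const_mul (50 / 69)).pow 20).const_mul c)).add
    (((he.const_mul (5 / 7)).pow 240).const_mul d)
  refine h.congr_deriv ?_
  simp only [lacunary]
  generalize Real.exp x = y
  rw [pow_succ (50 / 69 * y) 19, pow_succ (5 / 7 * y) 239]
  norm_num only [Nat.cast_ofNat]
  ring

theorem lacunary_pos {c d y : ℝ} (hc : 0 ≤ c) (hd : 0 ≤ d) (hy : 0 < y) :
    0 < lacunary c d y := by
  unfold lacunary; positivity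

theorem contDiff_lacunary_exp (c d : ℝ) :
    ContDiff ℝ 2 (fun v => lacunary c d (Real.exp v)) := by
  unfold lacunary
  exact (Real.contDiff_exp.add (contDiff_const.mul ((contDiff_const.mul Real.contDiff_exp).pow 20))).add
    (contDiff_const.mul ((contDiff_const.mul Real.contDiff_exp).pow 240))

theorem deriv_lacunary_exp (c d : ℝ) :
    deriv (fun v => lacunary c d (Real.exp v)) =
      fun v => lacunary (20 * c) (240 * d) (Real.exp v) :=
  funext fun x => (hasDerivAt_lacunary_exp c d x).deriv

theorem lacunary_injective_exp {c d : ℝ} (hc : 0 ≤ c) (hd : 0 ≤ d) :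
    Function.Injective (fun v => lacunary c d (Real.exp v)) := by
  refine (strictMono_of_deriv_pos fun x => ?_).injective
  rw [deriv_lacunary_exp]
  exact lacunary_pos (by positivity) (by positivity) (Real.exp_pos x)

/-- The value of `u² / 2 + F(v)` along the curve `u a(v) = 1`, in terms of `y = e^v`. -/
def energy (y : ℝ) : ℝ := (1 / lacunary 1 1 y) ^ 2 / 2 + lacunary (1 / 20) (1 / 240) y

theorem continuousOn_energy : ContinuousOn energy (Set.Ioi 0) := by
  have hc (c d : ℝ) : ContinuousOn (lacunary c d) (Set.Ioi 0) := by
    unfold lacunary; fun_prop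
  unfold energy
  exact (((continuousOn_const.div (hc 1 1) fun y hy =>
    (lacunary_pos zero_le_one zero_le_one hy).ne').pow 2).div_const 2).add (hc _ _)

/-- Points at which `energy` lies alternately above and below the level `1511 / 1000`. -/
def node : Fin 7 → ℝ := ![4 / 5, 1, 6 / 5, 133 / 100, 69 / 50, 281 / 200, 3 / 2]

theorem node_strictMono : StrictMono node := by
  rw [Fin.strictMono_iff_lt_succ]
  intro i
  fin_cases i <;> norm_num [node, Fin.succ]

theorem node_pos (i : Fin 7) : 0 < node i := by
  fin_cases i <;> norm_num [node]

theorem exists_energy_eq (i : Fin 6) :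
    ∃ y ∈ Set.Ioo (node i.castSucc) (node i.succ), energy y = 1511 / 1000 := by
  have h0 : 1511 / 1000 < energy (4 / 5) := by norm_num [energy, lacunary]
  have h1 : energy 1 < 1511 / 1000 := by norm_num [energy, lacunary]
  have h2 : 1511 / 1000 < energy (6 / 5) := by norm_num [energy, lacunary]
  have h3 : energy (133 / 100) < 1511 / 1000 := by norm_num [energy, lacunary]
  have h4 : 1511 / 1000 < energy (69 / 50) := by norm_num [energy, lacunary]
  have h5 : energy (281 / 200) < 1511 / 1000 := by norm_num [energy, lacunary]
  have h6 : 1511 / 1000 < energy (3 / 2) := by norm_num [energy, lacunary]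
  have hle := (node_strictMono i.castSucc_lt_succ).le
  have hcont : ContinuousOn energy (Set.Icc (node i.castSucc) (node i.succ)) :=
    continuousOn_energy.mono fun y hy => (node_pos _).trans_le hy.1
  have key : (1511 / 1000 : ℝ) ∈ Set.Ioo (energy (node i.castSucc)) (energy (node i.succ)) ∨
      (1511 / 1000 : ℝ) ∈ Set.Ioo (energy (node i.succ)) (energy (node i.castSucc)) := by
    fin_cases i
    exacts [.inr ⟨h1, h0⟩, .inl ⟨h1, h2⟩, .inr ⟨h3, h2⟩, .inl ⟨h3, h4⟩, .inr ⟨h5, h4⟩,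
      .inl ⟨h5, h6⟩]
  rcases key with h | h
  · exact intermediate_value_Ioo hle hcont h
  · exact intermediate_value_Ioo' hle hcont h

theorem exists_injective_energy_exp_eq :
    ∃ v : Fin 6 → ℝ, Function.Injective v ∧ ∀ i, energy (Real.exp (v i)) = 1511 / 1000 := by
  choose y hy he using exists_energy_eq
  have hmono : StrictMono y := fun i j hij =>
    (hy i).2.trans_le ((node_strictMono.monotone (Fin.succ_le_castSucc_iff.2 hij)).trans
      (hy j).1.le)
  have hpos (i : Fin 6) : 0 < y i := (node_pos _).trans (hy i).1
  refine ⟨fun i => Real.log (y i), fun i j h => ?_, fun i => ?_⟩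
  · exact hmono.injective (Real.log_injOn_pos (hpos i) (hpos j) h)
  · rw [Real.exp_log (hpos i), he]

/-- A three-row matrix whose last row vanishes and whose first two rows contain a nonzero minor
has rank two. -/
theorem rank_eq_two_of_row_eq_zero {n : Type*} [Fintype n] (A : Matrix (Fin 3) n ℝ)
    (h : A 2 = 0) (p q : n) (hdet : A 0 p * A 1 q - A 0 q * A 1 p ≠ 0) : A.rank = 2 := by
  apply le_antisymm
  · have hA : A = (!![1, 0; 0, 1; 0, 0] : Matrix (Fin 3) (Fin 2) ℝ) *
        A.submatrix ![0, 1] id := by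
      ext i j
      rw [Matrix.mul_apply, Fin.sum_univ_two]
      fin_cases i <;> simp [h]
    rw [hA]
    exact (Matrix.rank_mul_le_left _ _).trans (Matrix.rank_le_width _)
  · have hunit : IsUnit (A.submatrix ![0, 1] ![p, q]) := by
      rw [Matrix.isUnit_iff_isUnit_det, isUnit_iff_ne_zero, Matrix.det_fin_two]
      simpa using hdet
    have hrank := Matrix.rank_of_isUnit _ hunit
    rw [Fintype.card_fin] at hrank
    exact hrank.symm.le.trans (A.rank_submatrix_le _ _)

/-- **Lemma A.1.** There exist `a ∈ C²(ℝ)` with `a' > 0`, `a'' > 0`, `F` with `F' = a`,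
`N ≥ 6`, `N` distinct points `X_i = P(u_i, v_i) ∈ K_a`, and `Q ∈ ℝ^{3×2}` such that
`rank(A_X - Π^N(Q)) = 2`. -/
theorem stmt_15 : ∃ (a F : ℝ → ℝ) (N : ℕ) (u v : Fin N → ℝ)
    (Q : Matrix (Fin 3) (Fin 2) ℝ),
    ContDiff ℝ 2 a ∧ (∀ x : ℝ, 0 < deriv a x) ∧ (∀ x : ℝ, 0 < deriv (deriv a) x) ∧
    (∀ x : ℝ, HasDerivAt F (a x) x) ∧ 6 ≤ N ∧
    Function.Injective (fun i => Pmat a F (u i) (v i)) ∧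
    (AmatDiff a F u v Q).rank = 2 := by
  obtain ⟨v, hv, he⟩ := exists_injective_energy_exp_eq
  have ha (x : ℝ) : 0 < lacunary 1 1 (Real.exp x) :=
    lacunary_pos zero_le_one zero_le_one (Real.exp_pos x)
  refine ⟨fun x => lacunary 1 1 (Real.exp x), fun x => lacunary (1 / 20) (1 / 240) (Real.exp x),
    6, fun i => 1 / lacunary 1 1 (Real.exp (v i)), v, !![0, 0; 0, 0; 1, 1511 / 1000],
    contDiff_lacunary_exp 1 1, fun x => ?_, fun x => ?_, fun x => ?_, le_rfl, fun i j hij => ?_, ?_⟩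
  · rw [deriv_lacunary_exp]
    exact lacunary_pos (by norm_num) (by norm_num) (Real.exp_pos x)
  · rw [deriv_lacunary_exp, deriv_lacunary_exp]
    exact lacunary_pos (by norm_num) (by norm_num) (Real.exp_pos x)
  · simpa using hasDerivAt_lacunary_exp (1 / 20) (1 / 240) x
  · exact hv (by simpa [Pmat] using congrFun (congrFun hij 0) 1)
  · refine rank_eq_two_of_row_eq_zero _ ?_ (Sum.inl 0) (Sum.inl 1) ?_
    · ext (j | j)
      · simp [AmatDiff, Pmat, (ha (v j)).ne']
      · simpa [AmatDiff, Pmat, energy, sub_eq_zero] using he j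
    · have h0 := ha (v 0)
      have h1 := ha (v 1)
      have hne : lacunary 1 1 (Real.exp (v 0)) ≠ lacunary 1 1 (Real.exp (v 1)) := fun h =>
        absurd (hv (lacunary_injective_exp zero_le_one zero_le_one h)) (by decide)
      simp only [AmatDiff, Pmat, Matrix.of_apply, Sum.elim_inl, Matrix.cons_val_zero,
        Matrix.cons_val_one, Matrix.cons_val', sub_zero]
      generalize lacunary 1 1 (Real.exp (v 0)) = s at *
      generalize lacunary 1 1 (Real.exp (v 1)) = t at *
      intro h
      field_simp at h
      exact hne (by nlinarith)
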